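/- arXiv:0911.5620 — 4 statements merged into one kernel-verified Lean document; each statement's English description precedes it below -/
import Mathlib

section
/- In the setting of the poset P(Z_{i,j}, X_n, Y_{n−1}) (with f(x) = ∏_{j=1}^n(x − x_j), g(x) = ∏_{j=1}^{n−1}(x − y_j), T = ∏_{j=1}^{n−1}(x_j − y_j)(x_{j+1} − y_j), and G_{i,j} = (−1)^{j−i} G(P(Z_{i,j}, X_n, Y_{n−1})) for i ≤ j, G_{i,j} = 0 for i > j), suppose the Newton interpolation series of H = g/f at the nodes z_1, z_2, … converges absolutely at the pairwise distinct points t_1,…,t_p (distinct from all nodes). Then ∏_{i=1}^{p} g(t_i)/f(t_i) = T^{p} · Σ_{j_1 < ⋯ < j_p} det( G_{i, j_l} )_{i,l=1}^{p} · det( R(t_i, Z_{1, j_l − 1}) )_{i,l=1}^{p} / det( t_i^{l−1} )_{i,l=1}^{p}, where Z_{a,b} = {z_a,…,z_b} and R(t, Z_{a,b}) = ∏_{l=a}^{b}(t − z_l) (empty product = 1). -/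
open scoped Classical

noncomputable section

/-- The position `m` (as an element of `Fin n`) for `m : Fin (n-1)`. -/
def idxLo {n : ℕ} (m : Fin (n - 1)) : Fin n := ⟨m.1, by have := m.2; omega⟩

/-- The position `m+1` (as an element of `Fin n`) for `m : Fin (n-1)`. -/
def idxHi {n : ℕ} (m : Fin (n - 1)) : Fin n := ⟨m.1 + 1, by have := m.2; omega⟩

/-- The Greene sum of a finite poset, given by a strict order relation `r`
(`r u v` means `u ≺ v`) on a finite index type `ι`, with variables `x : ι → K`:
the sum over all linear extensions (words listing the elements from maximal to
minimal) of the product of the inverses of consecutive differences. -/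
def greeneSum {ι : Type*} [Fintype ι] {K : Type*} [Field K]
    (r : ι → ι → Prop) (x : ι → K) : K :=
  ∑ α : Equiv.Perm (Fin (Fintype.card ι)),
    if ∀ i j : Fin (Fintype.card ι),
        r ((Fintype.equivFin ι).symm (α i)) ((Fintype.equivFin ι).symm (α j)) → j < i
    then ∏ m : Fin (Fintype.card ι - 1),
        (x ((Fintype.equivFin ι).symm (α (idxLo m))) -
          x ((Fintype.equivFin ι).symm (α (idxHi m))))⁻¹
    else 0

/-- `Z` is a separating subset of the poset `(ι, r)`: elements of `Z` are pairwise
incomparable and every element outside `Z` is either below every element of `Z` or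
above every element of `Z`. -/
def IsSeparating {ι : Type*} (r : ι → ι → Prop) (Z : Set ι) : Prop :=
  (∀ a ∈ Z, ∀ b ∈ Z, a ≠ b → ¬ r a b ∧ ¬ r b a) ∧
  ∀ u ∉ Z, (∀ a ∈ Z, r u a) ∨ (∀ a ∈ Z, r a u)

/-- `P^≺`: the set of elements lying below every element of `Z`. -/
def below {ι : Type*} (r : ι → ι → Prop) (Z : Set ι) : Set ι := {u | ∀ a ∈ Z, r u a}

/-- `P^≻`: the set of elements lying above every element of `Z`. -/
def above {ι : Type*} (r : ι → ι → Prop) (Z : Set ι) : Set ι := {u | ∀ a ∈ Z, r a u}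

/-- Adjoin a new minimum (the element `none`) to a poset. -/
def adjoinMin {ι : Type*} (r : ι → ι → Prop) : Option ι → Option ι → Prop
  | none, some _ => True
  | some a, some b => r a b
  | _, _ => False

/-- Adjoin a new maximum (the element `none`) to a poset. -/
def adjoinMax {ι : Type*} (r : ι → ι → Prop) : Option ι → Option ι → Prop
  | some _, none => True
  | some a, some b => r a b
  | _, _ => False

/-- Extend variables `x : ι → K` to `Option ι` by assigning the value `z` to the
adjoined element `none`. -/
def extendVar {ι K : Type*} (x : ι → K) (z : K) : Option ι → K
  | none => z
  | some a => x a

/-- The Newton divided difference `Δ_{Z_k}[φ]` at the nodes `z 1, …, z k`. -/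
def dividedDiff {K : Type*} [Field K] {k : ℕ} (z : Fin k → K) (φ : K → K) : K :=
  ∑ j : Fin k, φ (z j) * (∏ i ∈ Finset.univ.erase j, (z j - z i))⁻¹


/-- The Newton divided difference `Δ_{Z_{a,b}}[φ]` at the consecutive nodes
`z a, z (a+1), …, z b` (equal to `0` when `a > b`). -/
def ddIcc {K : Type*} [Field K] (z : ℕ → K) (φ : K → K) (a b : ℕ) : K :=
  ∑ m ∈ Finset.Icc a b, φ (z m) * (∏ i ∈ (Finset.Icc a b).erase m, (z m - z i))⁻¹

/-- The poset `P(Z_k, X_n, Y_{n−1})`: `x_a ≺ z_b` for all `a, b`, and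
`y_a ≺ x_a`, `y_a ≺ x_{a+1}`. -/
def zigzagRel (k n : ℕ) :
    (Fin k ⊕ (Fin n ⊕ Fin (n - 1))) → (Fin k ⊕ (Fin n ⊕ Fin (n - 1))) → Prop :=
  fun a b =>
    match a, b with
    | Sum.inr _, Sum.inl _ => True
    | Sum.inr (Sum.inr i), Sum.inr (Sum.inl j) => j.1 = i.1 ∨ j.1 = i.1 + 1
    | _, _ => False

/-- `G_{a,b} = (−1)^{b−a} G(P(Z_{a,b}, X_n, Y_{n−1}))` for `a ≤ b` (nodes
`z a, …, z b`, 0-indexed), and `G_{a,b} = 0` for `a > b`. -/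
def signedZigzagGreene {n : ℕ} (z : ℕ → ℂ) (xv : Fin n → ℂ) (yv : Fin (n - 1) → ℂ)
    (a b : ℕ) : ℂ :=
  if a ≤ b then
    (-1 : ℂ) ^ (b - a) *
      greeneSum (zigzagRel (b + 1 - a) n)
        (Sum.elim (fun m : Fin (b + 1 - a) => z (a + m.1)) (Sum.elim xv yv))
  else 0

lemma ite_eq_ite_of_iff {α : Type*} {p q : Prop} {_ : Decidable p} {_ : Decidable q} {a b c : α}
    (h : p ↔ q) (hab : p → a = b) : (if p then a else c) = if q then b else c := by
  by_cases hp : p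
  · rw [if_pos hp, if_pos (h.1 hp), hab hp]
  · rw [if_neg hp, if_neg (mt h.2 hp)]

section Words

variable {ι : Type*} [DecidableEq ι] {K : Type*} [Field K]

/-- `v` is a word with distinct letters in `S` which lists elements from maximal to minimal. -/
def IsWord (r : ι → ι → Prop) (S : Finset ι) {k : ℕ} (v : Fin k → ι) : Prop :=
  Function.Injective v ∧ (∀ i, v i ∈ S) ∧ ∀ i j, r (v i) (v j) → j < i

/-- The Greene sum of the subposet `S` with a maximum of value `w` adjoined, computed by
repeatedly removing maximal elements (`k` of them). -/
def rootedSum (r : ι → ι → Prop) (x : ι → K) : ℕ → Finset ι → K → K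
  | 0, _, _ => 1
  | k + 1, S, w => ∑ a ∈ S,
      if ∀ b ∈ S, ¬ r a b then (w - x a)⁻¹ * rootedSum r x k (S.erase a) (x a) else 0

lemma isWord_iff {r : ι → ι → Prop} {S : Finset ι} {k : ℕ} (hS : S.card = k + 1)
    (v : Fin (k + 1) → ι) :
    IsWord r S v ↔
      v 0 ∈ S ∧ (∀ b ∈ S, ¬ r (v 0) b) ∧ IsWord r (S.erase (v 0)) (Fin.tail v) := by
  constructor
  · rintro ⟨h1, h2, h3⟩
    have himg : Finset.univ.image v = S := by
      refine Finset.eq_of_subset_of_card_le (fun a ha => ?_) ?_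
      · obtain ⟨i, -, rfl⟩ := Finset.mem_image.1 ha
        exact h2 i
      · rw [Finset.card_image_of_injective _ h1, hS]
        simp
    refine ⟨h2 0, fun b hb hr => ?_, fun i j h => ?_, fun i => ?_, fun i j h => ?_⟩
    · rw [← himg] at hb
      obtain ⟨i, -, rfl⟩ := Finset.mem_image.1 hb
      exact absurd (h3 _ _ hr) (by simp)
    · exact Fin.succ_injective _ (h1 h)
    · exact Finset.mem_erase.2 ⟨fun h => Fin.succ_ne_zero i (h1 h), h2 _⟩
    · exact Fin.succ_lt_succ_iff.1 (h3 _ _ h)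
  · rintro ⟨h0, hmax, h1, h2, h3⟩
    refine ⟨fun i j => ?_, fun i => ?_, fun i j => ?_⟩
    · induction i using Fin.cases with
      | zero =>
        induction j using Fin.cases with
        | zero => simp
        | succ j => exact fun h => absurd h.symm (Finset.mem_erase.1 (h2 j)).1
      | succ i =>
        induction j using Fin.cases with
        | zero => exact fun h => absurd h (Finset.mem_erase.1 (h2 i)).1
        | succ j => exact fun h => congrArg Fin.succ (h1 h)
    · induction i using Fin.cases with
      | zero => exact h0
      | succ i => exact (Finset.mem_erase.1 (h2 i)).2
    · induction i using Fin.cases with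
      | zero =>
        induction j using Fin.cases with
        | zero => exact fun h => absurd h (hmax _ h0)
        | succ j => exact fun h => absurd h (hmax _ (Finset.mem_erase.1 (h2 j)).2)
      | succ i =>
        induction j using Fin.cases with
        | zero => exact fun _ => Fin.succ_pos i
        | succ j => exact fun h => Fin.succ_lt_succ_iff.2 (h3 _ _ h)

variable [Fintype ι]

lemma sum_isWord_succ (r : ι → ι → Prop) {S : Finset ι} {k : ℕ} (hS : S.card = k + 1)
    (W : ι → (Fin k → ι) → K) :
    (∑ v : Fin (k + 1) → ι, if IsWord r S v then W (v 0) (Fin.tail v) else 0) =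
      ∑ a ∈ S, if ∀ b ∈ S, ¬ r a b then
        ∑ v : Fin k → ι, (if IsWord r (S.erase a) v then W a v else 0) else 0 := by
  rw [← (Fin.consEquiv fun _ : Fin (k + 1) => ι).sum_comp, Fintype.sum_prod_type,
    ← Finset.sum_subset (Finset.subset_univ S)]
  · refine Finset.sum_congr rfl fun a ha => ?_
    by_cases hmax : ∀ b ∈ S, ¬ r a b
    · rw [if_pos hmax]
      refine Finset.sum_congr rfl fun v _ => ?_
      refine if_congr ((isWord_iff hS _).trans ?_) rfl rfl
      exact (and_iff_right ha).trans (and_iff_right hmax)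
    · rw [if_neg hmax]
      refine Finset.sum_eq_zero fun v _ => ?_
      exact if_neg fun h => hmax ((isWord_iff hS _).1 h).2.1
  · intro a _ ha
    refine Finset.sum_eq_zero fun v _ => ?_
    exact if_neg fun h => ha ((isWord_iff hS _).1 h).1

lemma cons_comp_tail {α β : Type*} (x : α → β) {k : ℕ} (v : Fin (k + 1) → α) :
    (Fin.cons (x (v 0)) (x ∘ Fin.tail v) : Fin (k + 1) → β) = x ∘ v := by
  funext i
  induction i using Fin.cases with
  | zero => simp
  | succ i => simp [Fin.tail]

lemma sum_isWord_eq_rootedSum (r : ι → ι → Prop) (x : ι → K) (k : ℕ) :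
    ∀ (S : Finset ι), S.card = k → ∀ w : K,
    (∑ v : Fin k → ι, if IsWord r S v then
      ∏ m : Fin k, ((Fin.cons w (x ∘ v) : Fin (k + 1) → K) m.castSucc - x (v m))⁻¹ else 0) =
      rootedSum r x k S w := by
  induction k with
  | zero =>
    intro S _ w
    simp [rootedSum, IsWord, Function.injective_of_subsingleton]
  | succ k ih =>
    intro S hS w
    have h := sum_isWord_succ r hS fun a v => (w - x a)⁻¹ *
      ∏ m : Fin k, ((Fin.cons (x a) (x ∘ v) : Fin (k + 1) → K) m.castSucc - x (v m))⁻¹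
    rw [rootedSum]
    refine Eq.trans (Finset.sum_congr rfl fun v _ => ?_) (h.trans ?_)
    · rw [cons_comp_tail, Fin.prod_univ_succ]
      rfl
    · refine Finset.sum_congr rfl fun a ha => ?_
      refine ite_eq_ite_of_iff Iff.rfl fun _ => ?_
      rw [← ih _ (by rw [Finset.card_erase_of_mem ha, hS]; rfl), Finset.mul_sum]
      exact Finset.sum_congr rfl fun v _ => by rw [mul_ite, mul_zero]

lemma sum_perm_eq_sum_isWord (r : ι → ι → Prop) {N : ℕ} (e : ι ≃ Fin N)
    (W : (Fin N → ι) → K) :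
    (∑ α : Equiv.Perm (Fin N),
      if ∀ i j, r (e.symm (α i)) (e.symm (α j)) → j < i then W (e.symm ∘ α) else 0) =
      ∑ v : Fin N → ι, if IsWord r Finset.univ v then W v else 0 := by
  have hinj : Function.Injective fun α : Equiv.Perm (Fin N) => (e.symm ∘ α : Fin N → ι) :=
    fun α β h => Equiv.ext fun i => e.symm.injective (congrFun h i)
  rw [← Finset.sum_subset (Finset.subset_univ (Finset.univ.image
    fun α : Equiv.Perm (Fin N) => (e.symm ∘ α : Fin N → ι))),
    Finset.sum_image hinj.injOn]
  · refine Finset.sum_congr rfl fun α _ => if_congr ?_ rfl rfl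
    have hα := e.symm.injective.comp α.injective
    simp [IsWord, hα]
  · intro v _ hv
    refine if_neg fun hw => hv ?_
    have hbij : Function.Bijective (e ∘ v) :=
      Finite.injective_iff_bijective.1 (e.injective.comp hw.1)
    refine Finset.mem_image.2 ⟨Equiv.ofBijective _ hbij, Finset.mem_univ _, ?_⟩
    funext i
    simp

theorem greeneSum_eq_sum_rootedSum (r : ι → ι → Prop) (x : ι → K) {k : ℕ}
    (hk : Fintype.card ι = k + 1) :
    greeneSum r x = ∑ a : ι, if ∀ b, ¬ r a b then
      rootedSum r x k (Finset.univ.erase a) (x a) else 0 := by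
  have key : ∀ (N : ℕ) (e : ι ≃ Fin N), N = k + 1 →
      (∑ α : Equiv.Perm (Fin N), if ∀ i j, r (e.symm (α i)) (e.symm (α j)) → j < i then
        ∏ m : Fin (N - 1), (x (e.symm (α (idxLo m))) - x (e.symm (α (idxHi m))))⁻¹ else 0) =
      ∑ a : ι, if ∀ b, ¬ r a b then
        rootedSum r x k (Finset.univ.erase a) (x a) else 0 := by
    rintro _ e rfl
    refine (sum_perm_eq_sum_isWord r e fun v : Fin (k + 1) → ι =>
      ∏ m : Fin k, (x (v m.castSucc) - x (v m.succ))⁻¹).trans ?_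
    have hcard : (Finset.univ : Finset ι).card = k + 1 := hk
    have h := sum_isWord_succ r hcard fun a v =>
      ∏ m : Fin k, ((Fin.cons (x a) (x ∘ v) : Fin (k + 1) → K) m.castSucc - x (v m))⁻¹
    refine Eq.trans (Finset.sum_congr rfl fun v _ => ?_) (h.trans ?_)
    · rw [cons_comp_tail]
      rfl
    · refine Finset.sum_congr rfl fun a _ => ite_eq_ite_of_iff (by simp) fun _ => ?_
      exact sum_isWord_eq_rootedSum r x k _
        (by rw [Finset.card_erase_of_mem (Finset.mem_univ a), hcard]; rfl) _
  exact key _ (Fintype.equivFin ι) hk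

end Words

section Lagrange

open Polynomial

variable {κ : Type*} [DecidableEq κ] {K : Type*} [Field K]

lemma sum_inv_mul_eval_mul_prod_inv {s : Finset κ} {ν : κ → K} (hν : Set.InjOn ν s) {P : K[X]}
    (hP : P.degree < s.card) {w : K} (hw : ∀ a ∈ s, w ≠ ν a) :
    ∑ a ∈ s, (w - ν a)⁻¹ * (P.eval (ν a) * ∏ b ∈ s.erase a, (ν a - ν b)⁻¹) =
      P.eval w * ∏ a ∈ s, (w - ν a)⁻¹ := by
  have h := Lagrange.eval_interpolate_not_at_node (fun a => P.eval (ν a)) hw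
  rw [← Lagrange.eq_interpolate hν hP] at h
  rw [h, Lagrange.eval_nodal, Finset.prod_inv_distrib, mul_right_comm, mul_inv_cancel₀
    (Finset.prod_ne_zero_iff.2 fun a ha => sub_ne_zero.2 (hw a ha)), one_mul]
  refine Finset.sum_congr rfl fun a _ => ?_
  rw [Lagrange.nodalWeight]
  ring

lemma sum_eval_mul_prod_inv_of_monic {s : Finset κ} {ν : κ → K} (hν : Set.InjOn ν s) {P : K[X]}
    (hm : P.Monic) (hP : s.card = P.natDegree + 1) :
    ∑ a ∈ s, P.eval (ν a) * ∏ b ∈ s.erase a, (ν a - ν b)⁻¹ = 1 := by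
  have h := Lagrange.leadingCoeff_eq_sum hν (P := P)
    (by rw [hP, Polynomial.degree_eq_natDegree hm.ne_zero]; rfl)
  rw [hm.leadingCoeff] at h
  rw [h]
  refine Finset.sum_congr rfl fun a _ => ?_
  rw [Finset.prod_inv_distrib, div_eq_mul_inv]

end Lagrange

lemma disjSum_erase_inl {α β : Type*} [DecidableEq α] [DecidableEq β] (A : Finset α) (B : Finset β)
    (a : α) : (A.disjSum B).erase (Sum.inl a) = (A.erase a).disjSum B := by
  ext (x | x) <;> simp

lemma disjSum_erase_inr {α β : Type*} [DecidableEq α] [DecidableEq β] (A : Finset α) (B : Finset β)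
    (b : β) : (A.disjSum B).erase (Sum.inr b) = A.disjSum (B.erase b) := by
  ext (x | x) <;> simp

section Zigzag

variable {n : ℕ} {K : Type*} [Field K]

/-- The contribution of the minimal element `c` of the zigzag poset to `zigzagRatio`. -/
def zigzagFactor (xv : Fin n → K) (yv : Fin (n - 1) → K) (B : Finset (Fin n)) (c : Fin (n - 1))
    (w : K) : K :=
  (w - yv c)⁻¹ * (if idxLo c ∈ B then (w - yv c) / (xv (idxLo c) - yv c) else 1) *
    (if idxHi c ∈ B then (w - yv c) / (xv (idxHi c) - yv c) else 1)

/-- The closed form of the Greene sum of the subposet `B ∪ C` of the zigzag poset with a maximum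
of value `w` adjoined. -/
def zigzagRatio (xv : Fin n → K) (yv : Fin (n - 1) → K) (B : Finset (Fin n))
    (C : Finset (Fin (n - 1))) (w : K) : K :=
  (∏ b ∈ B, (w - xv b)⁻¹) * ∏ c ∈ C, zigzagFactor xv yv B c w

/-- The product of the inverse differences along the edges of `B ∪ C` ending at `c`. -/
def zigzagEdges (xv : Fin n → K) (yv : Fin (n - 1) → K) (B : Finset (Fin n)) (c : Fin (n - 1)) :
    K :=
  (if idxLo c ∈ B then (xv (idxLo c) - yv c)⁻¹ else 1) *
    (if idxHi c ∈ B then (xv (idxHi c) - yv c)⁻¹ else 1)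

lemma idxLo_ne_idxHi (c : Fin (n - 1)) : idxLo c ≠ idxHi c := by
  simp [idxLo, idxHi, Fin.ext_iff]

lemma idxLo_injective : Function.Injective (idxLo : Fin (n - 1) → Fin n) := fun a b h => by
  simpa [idxLo, Fin.ext_iff] using h

lemma card_filter_both_lt (B : Finset (Fin n)) (C : Finset (Fin (n - 1)))
    (hne : 0 < B.card + C.card) :
    (C.filter fun c => idxLo c ∈ B ∧ idxHi c ∈ B).card <
      B.card + (C.filter fun c => idxLo c ∉ B ∧ idxHi c ∉ B).card := by
  rcases B.eq_empty_or_nonempty with rfl | hB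
  · simpa using hne
  · refine Nat.lt_add_right _ ?_
    rw [← Finset.card_image_of_injective _ idxLo_injective]
    refine Finset.card_lt_card ((Finset.ssubset_iff_of_subset ?_).2
      ⟨B.max' hB, B.max'_mem hB, ?_⟩)
    · intro b hb
      obtain ⟨c, hc, rfl⟩ := Finset.mem_image.1 hb
      exact (Finset.mem_filter.1 hc).2.1
    · intro hb
      obtain ⟨c, hc, h⟩ := Finset.mem_image.1 hb
      have := B.le_max' _ (Finset.mem_filter.1 hc).2.2
      rw [← h, Fin.le_def] at this
      simp [idxLo, idxHi] at this

lemma zigzagFactor_eq {xv : Fin n → K} {yv : Fin (n - 1) → K} (hxy : ∀ b c, xv b - yv c ≠ 0)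
    (B : Finset (Fin n)) (c : Fin (n - 1)) {u : K} (hu : u ≠ yv c) :
    zigzagFactor xv yv B c u = zigzagEdges xv yv B c *
      (if idxLo c ∈ B ∧ idxHi c ∈ B then u - yv c else 1) *
        (if idxLo c ∉ B ∧ idxHi c ∉ B then (u - yv c)⁻¹ else 1) := by
  have h0 := sub_ne_zero.2 hu
  have h1 := hxy (idxLo c) c
  have h2 := hxy (idxHi c) c
  by_cases hl : idxLo c ∈ B <;> by_cases hh : idxHi c ∈ B <;>
    simp [zigzagFactor, zigzagEdges, hl, hh] <;> field_simp

lemma zigzagFactor_erase {xv : Fin n → K} {yv : Fin (n - 1) → K} (hxy : ∀ b c, xv b - yv c ≠ 0)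
    {B : Finset (Fin n)} {b : Fin n} (hb : b ∈ B) (c : Fin (n - 1)) :
    zigzagFactor xv yv (B.erase b) c (xv b) = zigzagEdges xv yv B c *
      (if idxLo c ∈ B ∧ idxHi c ∈ B then xv b - yv c else 1) *
        (if idxLo c ∉ B ∧ idxHi c ∉ B then (xv b - yv c)⁻¹ else 1) := by
  have h1 := hxy (idxLo c) c
  have h2 := hxy (idxHi c) c
  have h3 := idxLo_ne_idxHi c
  by_cases hl : b = idxLo c
  · subst hl
    by_cases hh : idxHi c ∈ B <;>
      simp [zigzagFactor, zigzagEdges, hb, hh, h3.symm]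
    all_goals field_simp
  by_cases hh : b = idxHi c
  · subst hh
    by_cases hl : idxLo c ∈ B <;>
      simp [zigzagFactor, zigzagEdges, hb, hl, h3]
    all_goals field_simp
  rw [← zigzagFactor_eq hxy B c (sub_ne_zero.1 (hxy b c))]
  simp [zigzagFactor, Ne.symm hl, Ne.symm hh]

lemma zigzagRatio_eq_sum {xv : Fin n → K} {yv : Fin (n - 1) → K}
    (hinj : Function.Injective (Sum.elim xv yv)) (B : Finset (Fin n)) (C : Finset (Fin (n - 1)))
    (hne : 0 < B.card + C.card) {w : K} (hx : ∀ b ∈ B, w ≠ xv b) (hy : ∀ c ∈ C, w ≠ yv c) :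
    zigzagRatio xv yv B C w =
      ∑ b ∈ B, (w - xv b)⁻¹ * zigzagRatio xv yv (B.erase b) C (xv b) +
      ∑ c ∈ C, if idxLo c ∉ B ∧ idxHi c ∉ B then
        (w - yv c)⁻¹ * zigzagRatio xv yv B (C.erase c) (yv c) else 0 := by
  have hxy : ∀ b c, xv b - yv c ≠ 0 := fun b c h => by
    have := @hinj (Sum.inl b) (Sum.inr c) (sub_eq_zero.1 h)
    simp at this
  have hyy : ∀ c c', c ≠ c' → yv c - yv c' ≠ 0 := fun c c' hc h => by
    have := @hinj (Sum.inr c) (Sum.inr c') (sub_eq_zero.1 h)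
    simp [hc] at this
  set C₀ := C.filter fun c => idxLo c ∉ B ∧ idxHi c ∉ B with hC₀
  set C₂ := C.filter fun c => idxLo c ∈ B ∧ idxHi c ∈ B with hC₂
  let ε : Fin (n - 1) → K := zigzagEdges xv yv B
  let P : Polynomial K := Polynomial.C (∏ c ∈ C, ε c) *
    ∏ c ∈ C₂, (Polynomial.X - Polynomial.C (yv c))
  have hP : ∀ u, P.eval u = (∏ c ∈ C, ε c) *
      ∏ c ∈ C, if idxLo c ∈ B ∧ idxHi c ∈ B then u - yv c else 1 := by
    intro u
    rw [Polynomial.eval_mul, Polynomial.eval_C, Polynomial.eval_prod, hC₂, Finset.prod_filter]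
    simp
  have hdeg : P.degree < (B.disjSum C₀).card := by
    refine (Polynomial.degree_mul_le _ _).trans_lt ((add_le_add_left
      Polynomial.degree_C_le _).trans_lt ?_)
    rw [zero_add, Finset.card_disjSum, Polynomial.degree_prod]
    simp only [Polynomial.degree_X_sub_C, Finset.sum_const, nsmul_eq_mul, mul_one]
    exact_mod_cast card_filter_both_lt B C hne
  have hfactor : ∀ (B' : Finset (Fin n)) (u : K), (∀ c ∈ C, zigzagFactor xv yv B' c u =
      ε c * (if idxLo c ∈ B ∧ idxHi c ∈ B then u - yv c else 1) *
        (if idxLo c ∉ B ∧ idxHi c ∉ B then (u - yv c)⁻¹ else 1)) →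
      zigzagRatio xv yv B' C u = P.eval u *
        ((∏ b ∈ B', (u - xv b)⁻¹) * ∏ c ∈ C₀, (u - yv c)⁻¹) := by
    intro B' u h
    rw [zigzagRatio, Finset.prod_congr rfl h, hP, hC₀, Finset.prod_filter,
      Finset.prod_mul_distrib, Finset.prod_mul_distrib]
    ring
  have hν : Set.InjOn (Sum.elim xv yv) (B.disjSum C₀ : Finset (Fin n ⊕ Fin (n - 1))) :=
    hinj.injOn
  have h := sum_inv_mul_eval_mul_prod_inv hν hdeg (w := w) (by
    rintro (b | c) h
    · exact hx b (by simpa using h)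
    · exact hy c (Finset.mem_filter.1 (Finset.inr_mem_disjSum.1 h)).1)
  simp only [Finset.sum_disjSum, Finset.prod_disjSum, disjSum_erase_inl, disjSum_erase_inr,
    Sum.elim_inl, Sum.elim_inr] at h
  rw [hfactor B w, ← h]
  · congr 1
    · refine Finset.sum_congr rfl fun b hb => ?_
      rw [hfactor (B.erase b) (xv b)]
      intro c _
      exact zigzagFactor_erase hxy hb c
    · rw [hC₀, Finset.sum_filter]
      refine Finset.sum_congr rfl fun c hc => ite_eq_ite_of_iff Iff.rfl fun hmin => ?_
      rw [hP, ← Finset.prod_erase C (a := c) (f := ε), ← Finset.prod_erase C (a := c)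
        (f := fun d => if idxLo d ∈ B ∧ idxHi d ∈ B then yv c - yv d else 1),
        ← Finset.filter_erase, Finset.prod_filter, zigzagRatio]
      · rw [Finset.prod_congr (f := fun d => zigzagFactor xv yv B d (yv c)) rfl (g := fun d => ε d *
          (if idxLo d ∈ B ∧ idxHi d ∈ B then yv c - yv d else 1) *
          (if idxLo d ∉ B ∧ idxHi d ∉ B then (yv c - yv d)⁻¹ else 1)),
          Finset.prod_mul_distrib, Finset.prod_mul_distrib]
        · ring
        · intro d hd
          exact zigzagFactor_eq hxy B d (sub_ne_zero.1 (hyy c d (Finset.ne_of_mem_erase hd).symm))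
      · simp [hmin]
      · simp [ε, zigzagEdges, hmin]
  · intro c hc
    exact zigzagFactor_eq hxy B c (hy c hc)

lemma rootedSum_zigzag {k : ℕ} (zv : Fin k → K) {xv : Fin n → K} {yv : Fin (n - 1) → K}
    (hinj : Function.Injective (Sum.elim xv yv)) (m : ℕ) :
    ∀ (B : Finset (Fin n)) (C : Finset (Fin (n - 1))), B.card + C.card = m →
      ∀ w : K, (∀ b ∈ B, w ≠ xv b) → (∀ c ∈ C, w ≠ yv c) →
      rootedSum (zigzagRel k n) (Sum.elim zv (Sum.elim xv yv)) m
        ((∅ : Finset (Fin k)).disjSum (B.disjSum C)) w = zigzagRatio xv yv B C w := by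
  have hne : ∀ {i j}, i ≠ j → Sum.elim xv yv i ≠ Sum.elim xv yv j := fun h => hinj.ne h
  induction m with
  | zero =>
    intro B C h w _ _
    obtain ⟨hB, hC⟩ := Nat.add_eq_zero_iff.1 h
    rw [Finset.card_eq_zero] at hB hC
    simp [rootedSum, zigzagRatio, hB, hC]
  | succ m ih =>
    intro B C hm w hx hy
    rw [zigzagRatio_eq_sum hinj B C (by omega) hx hy, rootedSum, Finset.sum_disjSum,
      Finset.sum_empty, zero_add, Finset.sum_disjSum]
    congr 1
    · refine Finset.sum_congr rfl fun b hb => ?_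
      have hc := Finset.card_erase_of_mem hb
      have hp := Finset.card_pos.2 ⟨b, hb⟩
      rw [if_pos, disjSum_erase_inr, disjSum_erase_inl, ih]
      · rfl
      · omega
      · intro b' hb'
        exact @hne (Sum.inl b) (Sum.inl b') (by simpa using (Finset.ne_of_mem_erase hb').symm)
      · intro c _
        exact @hne (Sum.inl b) (Sum.inr c) (by simp)
      · rintro (a | a | a) ha <;> simp_all [zigzagRel]
    · refine Finset.sum_congr rfl fun c hc => ite_eq_ite_of_iff ?_ fun hmin => ?_
      · constructor
        · intro h
          exact ⟨fun hl => h (Sum.inr (Sum.inl (idxLo c))) (by simpa using hl) (Or.inl rfl),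
            fun hl => h (Sum.inr (Sum.inl (idxHi c))) (by simpa using hl) (Or.inr rfl)⟩
        · rintro ⟨h1, h2⟩ (a | a | a) ha
          · simp at ha
          · rintro (h | h)
            · exact h1 (by
                rw [show idxLo c = a from Fin.ext h.symm]
                simpa using ha)
            · exact h2 (by
                rw [show idxHi c = a from Fin.ext h.symm]
                simpa using ha)
          · simp [zigzagRel]
      · have hc' := Finset.card_erase_of_mem hc
        have hp := Finset.card_pos.2 ⟨c, hc⟩
        rw [disjSum_erase_inr, disjSum_erase_inr, ih]
        · rfl
        · omega
        · intro b _
          exact @hne (Sum.inr c) (Sum.inl b) (by simp)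
        · intro c' hc'
          exact @hne (Sum.inr c) (Sum.inr c') (by simpa using (Finset.ne_of_mem_erase hc').symm)

lemma zigzagRatio_univ {xv : Fin n → K} {yv : Fin (n - 1) → K} {w : K} (hy : ∀ c, w ≠ yv c) :
    zigzagRatio xv yv Finset.univ Finset.univ w = (∏ c, (w - yv c)) / (∏ b, (w - xv b)) *
      (∏ c, ((xv (idxLo c) - yv c) * (xv (idxHi c) - yv c)))⁻¹ := by
  have h : ∀ c, zigzagFactor xv yv Finset.univ c w =
      (w - yv c) * ((xv (idxLo c) - yv c) * (xv (idxHi c) - yv c))⁻¹ := by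
    intro c
    have := sub_ne_zero.2 (hy c)
    simp only [zigzagFactor, Finset.mem_univ, if_true]
    field_simp
  simp only [zigzagRatio, h, Finset.prod_mul_distrib, Finset.prod_inv_distrib]
  ring

end Zigzag

section Chain

variable {κ : Type*} [DecidableEq κ] {K : Type*} [Field K]

/-- The Greene sum of an antichain `A` placed between a maximum of value `w` and a poset whose
Greene sum under a maximum of value `z a` is `φ a`. -/
def antichainSum (z φ : κ → K) (A : Finset κ) (w : K) : K :=
  ∑ a ∈ A, φ a * ((w - z a)⁻¹ * ∏ b ∈ A.erase a, ((w - z a) / ((w - z b) * (z b - z a))))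

lemma sum_mul_antichainSum_erase {z : κ → K} (φ : κ → K) {A : Finset κ} (hz : Set.InjOn z A)
    {m : ℕ} (hm : A.card = m + 2) (u : κ → K) :
    ∑ c ∈ A, u c * antichainSum z φ (A.erase c) (z c) =
      ∑ a ∈ A, φ a * (∏ b ∈ A.erase a, (z b - z a)⁻¹) *
        ∑ c ∈ A.erase a, u c * ((z c - z a) ^ m * ∏ b ∈ (A.erase a).erase c, (z c - z b)⁻¹) := by
  simp only [antichainSum, Finset.mul_sum]
  rw [Finset.sum_comm' (t' := A) (s' := fun a => A.erase a)
    (by simp only [Finset.mem_erase]; tauto)]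
  refine Finset.sum_congr rfl fun a ha => Finset.sum_congr rfl fun c hc => ?_
  have hca := Finset.mem_erase.1 hc
  have h0 : z c - z a ≠ 0 := sub_ne_zero.2 fun h => hca.1 (hz hca.2 ha h)
  have hcard : ((A.erase a).erase c).card = m := by
    rw [Finset.card_erase_of_mem hc, Finset.card_erase_of_mem ha, hm]
    rfl
  rw [Finset.erase_right_comm, ← Finset.mul_prod_erase _ _ hc, Finset.prod_div_distrib,
    Finset.prod_const, hcard, Finset.prod_mul_distrib, Finset.prod_inv_distrib,
    Finset.prod_inv_distrib]
  ring

lemma antichainSum_eq_sum {z : κ → K} (φ : κ → K) {A : Finset κ} (hz : Set.InjOn z A)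
    {m : ℕ} (hm : A.card = m + 2) {w : K} (hw : ∀ a ∈ A, w ≠ z a) :
    ∑ c ∈ A, (w - z c)⁻¹ * antichainSum z φ (A.erase c) (z c) = antichainSum z φ A w := by
  rw [sum_mul_antichainSum_erase φ hz hm, antichainSum]
  refine Finset.sum_congr rfl fun a ha => ?_
  have hcard : (A.erase a).card = m + 1 := by
    rw [Finset.card_erase_of_mem ha, hm]
    rfl
  have h := sum_inv_mul_eval_mul_prod_inv (s := A.erase a) (ν := z)
    (hz.mono (by simp)) (P := (Polynomial.X - Polynomial.C (z a)) ^ m)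
    (by
      rw [hcard, Polynomial.degree_pow, Polynomial.degree_X_sub_C, nsmul_one]
      exact_mod_cast m.lt_succ_self) (w := w) fun b hb => hw b (Finset.mem_of_mem_erase hb)
  simp only [Polynomial.eval_pow, Polynomial.eval_sub, Polynomial.eval_X,
    Polynomial.eval_C] at h
  have h0 := sub_ne_zero.2 (hw a ha)
  rw [h, Finset.prod_div_distrib, Finset.prod_const, hcard, Finset.prod_mul_distrib,
    Finset.prod_inv_distrib, Finset.prod_inv_distrib, pow_succ]
  field_simp

lemma sum_antichainSum_erase {z : κ → K} (φ : κ → K) {A : Finset κ} (hz : Set.InjOn z A)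
    {m : ℕ} (hm : A.card = m + 2) :
    ∑ c ∈ A, antichainSum z φ (A.erase c) (z c) =
      ∑ a ∈ A, φ a * ∏ b ∈ A.erase a, (z b - z a)⁻¹ := by
  have h := sum_mul_antichainSum_erase φ hz hm fun _ => 1
  simp only [one_mul] at h
  rw [h]
  refine Finset.sum_congr rfl fun a ha => ?_
  have h1 := sum_eval_mul_prod_inv_of_monic (s := A.erase a) (ν := z)
    (hz.mono (by simp)) (P := (Polynomial.X - Polynomial.C (z a)) ^ m)
    ((Polynomial.monic_X_sub_C _).pow m) (by
      rw [Finset.card_erase_of_mem ha, hm, Polynomial.natDegree_pow, Polynomial.natDegree_X_sub_C,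
        mul_one]
      rfl)
  simp only [Polynomial.eval_pow, Polynomial.eval_sub, Polynomial.eval_X,
    Polynomial.eval_C] at h1
  rw [h1, mul_one]

end Chain

section Greene

variable {k n : ℕ} {K : Type*} [Field K]

lemma rootedSum_antichain_succ (zv : Fin k → K) (x : Fin n ⊕ Fin (n - 1) → K)
    {A : Finset (Fin k)} (hA : A.Nonempty) (l : ℕ) (w : K) :
    rootedSum (zigzagRel k n) (Sum.elim zv x) (l + 1) (A.disjSum Finset.univ) w =
      ∑ c ∈ A, (w - zv c)⁻¹ * rootedSum (zigzagRel k n) (Sum.elim zv x) l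
        ((A.erase c).disjSum Finset.univ) (zv c) := by
  obtain ⟨a, ha⟩ := hA
  rw [rootedSum, Finset.sum_disjSum, add_eq_left.2]
  · refine Finset.sum_congr rfl fun c _ => ?_
    rw [if_pos, disjSum_erase_inl]
    · rfl
    · rintro (b | b | b) _ <;> simp [zigzagRel]
  · refine Finset.sum_eq_zero fun c _ => if_neg fun h => h (Sum.inl a) (by simpa using ha) ?_
    rcases c with c | c <;> trivial

lemma rootedSum_antichain {zv : Fin k → K} (hz : Function.Injective zv) {xv : Fin n → K}
    {yv : Fin (n - 1) → K} (hinj : Function.Injective (Sum.elim xv yv))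
    (hzx : ∀ a b, zv a ≠ xv b) (hzy : ∀ a c, zv a ≠ yv c) (m : ℕ) :
    ∀ A : Finset (Fin k), A.card = m + 1 → ∀ w : K, (∀ a ∈ A, w ≠ zv a) →
      rootedSum (zigzagRel k n) (Sum.elim zv (Sum.elim xv yv)) (m + 1 + (n + (n - 1)))
        (A.disjSum Finset.univ) w =
      antichainSum zv (fun a => zigzagRatio xv yv Finset.univ Finset.univ (zv a)) A w := by
  induction m with
  | zero =>
    intro A hA w _
    obtain ⟨a, rfl⟩ := Finset.card_eq_one.1 hA
    rw [zero_add, add_comm, rootedSum_antichain_succ _ _ (by simp)]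
    have := rootedSum_zigzag zv hinj (n + (n - 1)) Finset.univ Finset.univ (by simp) (zv a)
      (fun b _ => hzx a b) fun c _ => hzy a c
    rw [Finset.univ_disjSum_univ] at this
    rw [Finset.sum_singleton, Finset.erase_singleton, this, antichainSum, Finset.sum_singleton]
    simp [mul_comm]
  | succ m ih =>
    intro A hA w hw
    rw [show m + 1 + 1 + (n + (n - 1)) = m + 1 + (n + (n - 1)) + 1 by ring,
      rootedSum_antichain_succ _ _ (Finset.card_pos.1 (by omega)),
      ← antichainSum_eq_sum _ hz.injOn hA hw]
    refine Finset.sum_congr rfl fun c hc => ?_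
    rw [ih _ (by rw [Finset.card_erase_of_mem hc, hA]; rfl)]
    exact fun a ha => hz.ne (Finset.ne_of_mem_erase ha).symm

theorem greeneSum_zigzag {zv : Fin k → K} (hk : 0 < k) (hz : Function.Injective zv)
    {xv : Fin n → K} {yv : Fin (n - 1) → K} (hinj : Function.Injective (Sum.elim xv yv))
    (hzx : ∀ a b, zv a ≠ xv b) (hzy : ∀ a c, zv a ≠ yv c) :
    greeneSum (zigzagRel k n) (Sum.elim zv (Sum.elim xv yv)) =
      ∑ a, zigzagRatio xv yv Finset.univ Finset.univ (zv a) *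
        ∏ b ∈ Finset.univ.erase a, (zv b - zv a)⁻¹ := by
  obtain ⟨m, rfl⟩ := Nat.exists_eq_succ_of_ne_zero hk.ne'
  have hcard : Fintype.card (Fin (m + 1) ⊕ (Fin n ⊕ Fin (n - 1))) = m + (n + (n - 1)) + 1 := by
    simp only [Fintype.card_sum, Fintype.card_fin]
    ring
  rw [greeneSum_eq_sum_rootedSum _ _ hcard, Fintype.sum_sum_type, add_eq_left.2]
  · have hterm : ∀ c : Fin (m + 1),
        (if ∀ b, ¬ zigzagRel (m + 1) n (Sum.inl c) b then
          rootedSum (zigzagRel (m + 1) n) (Sum.elim zv (Sum.elim xv yv)) (m + (n + (n - 1)))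
            (Finset.univ.erase (Sum.inl c)) (Sum.elim zv (Sum.elim xv yv) (Sum.inl c)) else 0) =
        rootedSum (zigzagRel (m + 1) n) (Sum.elim zv (Sum.elim xv yv)) (m + (n + (n - 1)))
          ((Finset.univ.erase c).disjSum Finset.univ) (zv c) := by
      intro c
      rw [if_pos, ← Finset.univ_disjSum_univ, disjSum_erase_inl]
      · rfl
      · rintro (b | b | b) <;> simp [zigzagRel]
    rw [Finset.sum_congr rfl fun c _ => hterm c]
    rcases m with _ | m
    · have := rootedSum_zigzag zv hinj (n + (n - 1)) Finset.univ Finset.univ (by simp) (zv 0)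
        (fun b _ => hzx 0 b) fun c _ => hzy 0 c
      rw [Finset.univ_disjSum_univ] at this
      simpa using this
    · rw [← sum_antichainSum_erase _ hz.injOn (m := m) (by simp)]
      refine Finset.sum_congr rfl fun c _ => ?_
      exact rootedSum_antichain hz hinj hzx hzy m _ (by simp) _
        fun a ha => hz.ne (Finset.ne_of_mem_erase ha).symm
  · refine Finset.sum_eq_zero fun c _ => if_neg fun h => h (Sum.inl 0) ?_
    rcases c with c | c <;> trivial

end Greene

lemma mul_signedZigzagGreene_eq_ddIcc {n : ℕ} (z : ℕ → ℂ) (xv : Fin n → ℂ) (yv : Fin (n - 1) → ℂ)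
    (hinj : Function.Injective
      (Sum.elim z (Sum.elim xv yv) : ℕ ⊕ (Fin n ⊕ Fin (n - 1)) → ℂ)) (a b : ℕ) :
    (∏ j : Fin (n - 1), ((xv (idxLo j) - yv j) * (xv (idxHi j) - yv j))) *
        signedZigzagGreene z xv yv a b =
      ddIcc z (fun w => (∏ m : Fin (n - 1), (w - yv m)) / ∏ m : Fin n, (w - xv m)) a b := by
  unfold signedZigzagGreene ddIcc
  split_ifs with hab
  · have hz : Function.Injective z := hinj.comp Sum.inl_injective
    have hxy : Function.Injective (Sum.elim xv yv) := hinj.comp Sum.inr_injective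
    have hzx : ∀ a b, z a ≠ xv b := fun a b h => by
      simpa using @hinj (Sum.inl a) (Sum.inr (Sum.inl b)) h
    have hzy : ∀ a c, z a ≠ yv c := fun a c h => by
      simpa using @hinj (Sum.inl a) (Sum.inr (Sum.inr c)) h
    have hT : (∏ j : Fin (n - 1), ((xv (idxLo j) - yv j) * (xv (idxHi j) - yv j))) ≠ 0 := by
      have h : ∀ b c, xv b - yv c ≠ 0 := fun b c h => by
        simpa using @hxy (Sum.inl b) (Sum.inr c) (sub_eq_zero.1 h)
      exact Finset.prod_ne_zero_iff.2 fun j _ => mul_ne_zero (h _ _) (h _ _)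
    obtain ⟨E, hEv⟩ : ∃ E : Fin (b + 1 - a) ↪ ℕ, ∀ m, E m = a + m.1 :=
      ⟨⟨fun m => a + m.1, fun i j (h : a + i.1 = a + j.1) => Fin.ext (Nat.add_left_cancel h)⟩,
        fun _ => rfl⟩
    have hE : Finset.univ.map E = Finset.Icc a b := by
      ext m
      simp only [Finset.mem_map, Finset.mem_univ, true_and, hEv, Finset.mem_Icc]
      constructor
      · rintro ⟨i, rfl⟩
        have := i.2
        omega
      · intro h
        exact ⟨⟨m - a, by omega⟩, by simp only; omega⟩
    simp only [← hEv]
    rw [greeneSum_zigzag (by omega) (fun i j h => E.injective (hz h)) hxy (fun _ => hzx _)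
      fun _ => hzy _, ← hE, Finset.sum_map, Finset.mul_sum, Finset.mul_sum]
    refine Finset.sum_congr rfl fun m _ => ?_
    rw [← Finset.map_erase, Finset.prod_map, zigzagRatio_univ (hzy _)]
    have hsign : ∏ i ∈ Finset.univ.erase m, (z (E i) - z (E m))⁻¹ =
        (-1) ^ (b - a) * (∏ i ∈ Finset.univ.erase m, (z (E m) - z (E i)))⁻¹ := by
      rw [Finset.prod_inv_distrib, ← Finset.prod_congr rfl fun i _ => neg_sub (z (E m)) (z (E i)),
        Finset.prod_neg, Finset.card_erase_of_mem (Finset.mem_univ m), Finset.card_univ,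
        Fintype.card_fin, show b + 1 - a - 1 = b - a by omega, mul_inv, ← inv_pow]
      norm_num
    have hsq : ((-1 : ℂ) ^ (b - a)) * (-1) ^ (b - a) = 1 := by
      rw [← mul_pow]
      simp
    rw [hsign]
    generalize (∏ i ∈ Finset.univ.erase m, (z (E m) - z (E i)))⁻¹ = D
    generalize (∏ c, (z (E m) - yv c)) / (∏ b, (z (E m) - xv b)) = R
    field_simp
    linear_combination R * D * hsq
  · rw [Finset.Icc_eq_empty hab]
    simp

section CauchyBinet

lemma summable_norm_and_hasSum_prod_pi {ι : Type*} {p : ℕ} (f : Fin p → ι → ℂ) (s : Fin p → ℂ)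
    (hf : ∀ i, Summable fun j => ‖f i j‖) (hs : ∀ i, HasSum (f i) (s i)) :
    (Summable fun F : Fin p → ι => ‖∏ i, f i (F i)‖) ∧
      HasSum (fun F : Fin p → ι => ∏ i, f i (F i)) (∏ i, s i) := by
  induction p with
  | zero => exact ⟨Summable.of_finite, by simp⟩
  | succ p ih =>
    obtain ⟨h1, h2⟩ := ih (fun i => f i.succ) (fun i => s i.succ) (fun i => hf _) fun i => hs _
    have hn := (hf 0).mul_norm h1
    let e := Fin.consEquiv fun _ : Fin (p + 1) => ι
    have he : ((fun F : Fin (p + 1) → ι => ∏ i, f i (F i)) ∘ e) =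
        fun x => f 0 x.1 * ∏ i : Fin p, f i.succ (x.2 i) := by
      funext x
      simp [e, Fin.prod_univ_succ, Fin.consEquiv]
    constructor
    · rw [← e.summable_iff]
      have hn' : ((fun F : Fin (p + 1) → ι => ‖∏ i, f i (F i)‖) ∘ e) =
          fun x => ‖f 0 x.1 * ∏ i : Fin p, f i.succ (x.2 i)‖ :=
        funext fun x => by
          have h := congrFun he x
          simp only [Function.comp_apply] at h ⊢
          rw [h]
      rw [hn']
      exact hn
    · have hm : Summable fun x : ι × (Fin p → ι) => f 0 x.1 * ∏ i : Fin p, f i.succ (x.2 i) :=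
        Summable.of_norm hn
      have h := (hs 0).mul h2 hm
      rw [← he] at h
      rw [Fin.prod_univ_succ]
      exact (Equiv.hasSum_iff e).1 h

lemma injective_and_range_strictMono_comp_perm {p : ℕ} :
    Function.Injective (fun x : {J : Fin p → ℕ // StrictMono J} × Equiv.Perm (Fin p) =>
        (x.1.1 ∘ x.2 : Fin p → ℕ)) ∧
      Set.range (fun x : {J : Fin p → ℕ // StrictMono J} × Equiv.Perm (Fin p) =>
        (x.1.1 ∘ x.2 : Fin p → ℕ)) = {F | Function.Injective F} := by
  constructor
  · rintro ⟨J, σ⟩ ⟨J', σ'⟩ h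
    have hr : Set.range J.1 = Set.range J'.1 := by
      have := congrArg Set.range h
      simpa [Set.range_comp] using this
    have hJ : J = J' := Subtype.ext ((J.2.range_inj J'.2).1 hr)
    subst hJ
    refine Prod.ext rfl (Equiv.ext fun i => J.2.injective (congrFun h i))
  · ext F
    constructor
    · rintro ⟨⟨J, σ⟩, rfl⟩
      exact J.2.injective.comp σ.injective
    · intro hF
      refine ⟨⟨⟨F ∘ Tuple.sort F, (Tuple.monotone_sort F).strictMono_of_injective
        (Function.Injective.comp hF (Tuple.sort F).injective)⟩, (Tuple.sort F).symm⟩, ?_⟩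
      funext i
      simp

/-- The Cauchy–Binet formula for absolutely convergent infinite matrix products. -/
theorem hasSum_det_mul_det {p : ℕ} (A : Fin p → ℕ → ℂ) (B : ℕ → Fin p → ℂ)
    (M : Matrix (Fin p) (Fin p) ℂ)
    (habs : ∀ i q, Summable fun j => ‖A i j * B j q‖)
    (hsum : ∀ i q, HasSum (fun j => A i j * B j q) (M i q)) :
    HasSum (fun J : {J : Fin p → ℕ // StrictMono J} =>
      (Matrix.of fun i l => A i (J.1 l)).det * (Matrix.of fun i l => B (J.1 l) i).det) M.det := by
  have hF : HasSum (fun F : Fin p → ℕ =>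
      (∏ i, A i (F i)) * (Matrix.of fun q i => B (F i) q).det) M.det := by
    rw [← Matrix.det_transpose M, Matrix.det_apply']
    have := hasSum_sum (s := Finset.univ) fun (τ : Equiv.Perm (Fin p)) _ =>
      (summable_norm_and_hasSum_prod_pi _ _ (fun i => habs i (τ i))
        (fun i => hsum i (τ i))).2.mul_left ((Equiv.Perm.sign τ : ℤ) : ℂ)
    refine this.congr_fun fun F => ?_
    rw [Matrix.det_apply', Finset.mul_sum]
    refine Finset.sum_congr rfl fun τ _ => ?_
    simp only [Matrix.of_apply, Finset.prod_mul_distrib]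
    ring
  obtain ⟨hi, hr⟩ := injective_and_range_strictMono_comp_perm (p := p)
  rw [← hi.hasSum_iff] at hF
  · refine hF.prod_fiberwise fun J => ?_
    convert hasSum_fintype _ using 1
    rw [← Matrix.det_transpose (Matrix.of fun i l => A i (J.1 l)), Matrix.det_apply',
      Finset.sum_mul]
    refine Finset.sum_congr rfl fun σ _ => ?_
    have := Matrix.det_permute' σ (Matrix.of fun i l => B (J.1 l) i)
    simp only [Matrix.submatrix, id, Matrix.of_apply] at this
    simp only [Function.comp_apply, this, Matrix.transpose_apply, Matrix.of_apply]
    ring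
  · intro F hF'
    rw [hr] at hF'
    simp only [Set.mem_ofPred_eq, Function.Injective, not_forall] at hF'
    obtain ⟨a, b, hab, hne⟩ := hF'
    rw [Matrix.det_zero_of_column_eq hne fun q => ?_, mul_zero]
    simp [hab]

/-- Newton polynomials have the Vandermonde determinant. -/
lemma det_newton_eq_det_pow {p : ℕ} (z : ℕ → ℂ) (t : Fin p → ℂ) :
    (Matrix.of fun i l : Fin p => ∏ m ∈ Finset.range l.1, (t i - z m)).det =
      (Matrix.of fun i l : Fin p => t i ^ l.1).det := by
  have := Matrix.det_eval_matrixOfPolynomials_eq_det_vandermonde t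
    (fun l : Fin p => ∏ m ∈ Finset.range l.1, (Polynomial.X - Polynomial.C (z m)))
    (fun l => by simp) (fun l => Polynomial.monic_prod_X_sub_C _ _)
  simp only [Polynomial.eval_prod, Polynomial.eval_sub, Polynomial.eval_X,
    Polynomial.eval_C] at this
  exact this.symm

/-- Multiplying the Newton expansions of `H` at `p` points by the Cauchy–Binet formula. -/
theorem hasSum_det_newton {p : ℕ} (z : ℕ → ℂ) (t : Fin p → ℂ) (ht : Function.Injective t)
    (D : ℕ → ℕ → ℂ) (hD : ∀ a b, b < a → D a b = 0) (H : ℂ → ℂ)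
    (habs : ∀ i q : Fin p,
      Summable fun j : ℕ => ‖D i.1 j * ∏ l ∈ Finset.Ico i.1 j, (t q - z l)‖)
    (hsum : ∀ i q : Fin p,
      HasSum (fun j : ℕ => D i.1 j * ∏ l ∈ Finset.Ico i.1 j, (t q - z l)) (H (t q))) :
    HasSum (fun J : {J : Fin p → ℕ // StrictMono J} =>
        (Matrix.of fun i l : Fin p => D i.1 (J.1 l)).det *
          (Matrix.of fun i l : Fin p => ∏ m ∈ Finset.range (J.1 l), (t i - z m)).det /
          (Matrix.of fun i l : Fin p => t i ^ l.1).det)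
      (∏ i : Fin p, H (t i)) := by
  have hV : (Matrix.of fun i l : Fin p => t i ^ l.1).det ≠ 0 :=
    Matrix.det_vandermonde_ne_zero_iff.2 ht
  have key : ∀ (i q : Fin p) (j : ℕ),
      D i.1 j * ∏ m ∈ Finset.range j, (t q - z m) =
        (∏ m ∈ Finset.range i.1, (t q - z m)) *
          (D i.1 j * ∏ l ∈ Finset.Ico i.1 j, (t q - z l)) := by
    intro i q j
    rcases lt_or_ge j i.1 with h | h
    · simp [hD _ _ h]
    · rw [← Finset.prod_range_mul_prod_Ico _ h]
      ring
  have := hasSum_det_mul_det (fun i : Fin p => D i.1)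
    (fun j q => ∏ m ∈ Finset.range j, (t q - z m))
    (Matrix.of fun i q => H (t q) * ∏ m ∈ Finset.range i.1, (t q - z m))
    (fun i q => by
      simp only [key, norm_mul (∏ m ∈ Finset.range i.1, (t q - z m))]
      exact (habs i q).mul_left _)
    (fun i q => by
      simp only [key, Matrix.of_apply, mul_comm (H (t q))]
      exact (hsum i q).mul_left _)
  have hdet : (Matrix.of fun i q : Fin p =>
      H (t q) * ∏ m ∈ Finset.range i.1, (t q - z m)).det =
      (∏ i, H (t i)) * (Matrix.of fun i l : Fin p => t i ^ l.1).det := by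
    have h := Matrix.det_mul_row (fun q => H (t q))
      (Matrix.of fun i q : Fin p => ∏ m ∈ Finset.range i.1, (t q - z m))
    simp only [Matrix.of_apply] at h
    rw [h, ← det_newton_eq_det_pow z t, ← Matrix.det_transpose]
    rfl
  rw [hdet] at this
  have := this.div_const (Matrix.of fun i l : Fin p => t i ^ l.1).det
  rwa [mul_div_cancel_right₀ _ hV] at this

end CauchyBinet

/-- With `H = g/f`, `G_{i,j} = (−1)^{j−i} G(P(Z_{i,j}, X_n, Y_{n−1}))`,
and `T = ∏_j (x_j − y_j)(x_{j+1} − y_j)`: if the Newton series of `H` at the nodes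
`z_1, z_2, …` converge absolutely at the pairwise distinct points `t_1, …, t_p`, then
`∏_i g(t_i)/f(t_i) = T^p Σ_{j_1<⋯<j_p} det(G_{i,j_l}) det(R(t_i, Z_{1,j_l−1})) / det(t_i^{l−1})`. -/
theorem prod_ratio_eq_sum_det_greene
    {n : ℕ} (hn : 0 < n) (z : ℕ → ℂ) (xv : Fin n → ℂ) (yv : Fin (n - 1) → ℂ)
    (hinj : Function.Injective
      (Sum.elim z (Sum.elim xv yv) : ℕ ⊕ (Fin n ⊕ Fin (n - 1)) → ℂ))
    {p : ℕ} (hp : 0 < p) (t : Fin p → ℂ) (ht : Function.Injective t)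
    (htz : ∀ i : Fin p, ∀ m : ℕ, t i ≠ z m)
    (htx : ∀ i : Fin p, ∀ j : Fin n, t i ≠ xv j)
    (H : ℂ → ℂ)
    (hH : H = fun w => (∏ m : Fin (n - 1), (w - yv m)) / ∏ m : Fin n, (w - xv m))
    (T : ℂ)
    (hT : T = ∏ j : Fin (n - 1), ((xv (idxLo j) - yv j) * (xv (idxHi j) - yv j)))
    (habs : ∀ i q : Fin p,
      Summable fun j : ℕ => ‖ddIcc z H i.1 j * ∏ l ∈ Finset.Ico i.1 j, (t q - z l)‖)
    (hsum : ∀ i q : Fin p,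
      HasSum (fun j : ℕ => ddIcc z H i.1 j * ∏ l ∈ Finset.Ico i.1 j, (t q - z l))
        (H (t q))) :
    HasSum
      (fun J : {J : Fin p → ℕ // StrictMono J} =>
        T ^ p *
          (Matrix.det (Matrix.of fun i l : Fin p =>
              signedZigzagGreene z xv yv i.1 (J.1 l)) *
            Matrix.det (Matrix.of fun i l : Fin p =>
              ∏ m ∈ Finset.range (J.1 l), (t i - z m)) /
            Matrix.det (Matrix.of fun i l : Fin p => t i ^ l.1)))
      (∏ i : Fin p, H (t i)) := by
  subst hT
  have hG := mul_signedZigzagGreene_eq_ddIcc z xv yv hinj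
  rw [← hH] at hG
  have h := hasSum_det_newton z t ht (ddIcc z H)
    (fun a b hab => by simp [ddIcc, Finset.Icc_eq_empty (not_le.2 hab)]) H habs hsum
  refine h.congr_fun fun J => ?_
  simp only [← hG]
  rw [show (Matrix.of fun i l : Fin p =>
      (∏ j : Fin (n - 1), ((xv (idxLo j) - yv j) * (xv (idxHi j) - yv j))) *
        signedZigzagGreene z xv yv i.1 (J.1 l)) =
      (∏ j : Fin (n - 1), ((xv (idxLo j) - yv j) * (xv (idxHi j) - yv j))) •
        Matrix.of fun i l : Fin p => signedZigzagGreene z xv yv i.1 (J.1 l) from rfl,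
    Matrix.det_smul, Fintype.card_fin]
  ring

end
end

section
/- Let P_1,…,P_n be connected finite posets, each containing two distinguished elements whose variables are z and x, joined by an edge of the Hasse diagram (x ≺ z is a covering relation); the other variables of the P_i are fixed complex numbers. Write the Greene sum of P_i as G(P_i) = G′(P_i)/(z − x) with G′(P_i) = (z − x)·G(P_i), and split G(P_i) = G″(P_i)/(z − x) + G‴(P_i), where G″(P_i)/(z − x) is the sum of the terms of G(P_i) over linear extensions in which z immediately precedes x, and G‴(P_i) is the sum over the remaining linear extensions. Set G′_i = ∏_{j=1}^{i} G′(P_j) and G″_i = ∏_{j=1}^{i} G″(P_j). Let F be analytic on a neighborhood of the closed disc bounded by a positively oriented circle γ that encloses x and all variables of all P_i, with all denominators nonvanishing on γ. Then for every n > 1: F(x) = −Σ_{i=1}^{n} (1/(2πi)) ∮_γ G′_{i−1} G‴(P_i) F(z) / G″_i dz + (1/(2πi)) ∮_γ G′_n F(z) / (G″_n (z − x)) dz, where G′_0 = 1 and in the integrands z is the integration variable. -/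
open scoped Classical Real

noncomputable section

/-- The part of the Greene sum of the finite poset `(ι, r)` (with variables `x`)
coming from the linear extensions (words from maximal to minimal) satisfying the
extra predicate `Q`. -/
def greeneSumRestricted {ι : Type*} [Fintype ι] {K : Type*} [Field K]
    (r : ι → ι → Prop) (x : ι → K) (Q : (Fin (Fintype.card ι) → ι) → Prop) : K :=
  ∑ α : Equiv.Perm (Fin (Fintype.card ι)),
    if (∀ i j : Fin (Fintype.card ι),
          r ((Fintype.equivFin ι).symm (α i)) ((Fintype.equivFin ι).symm (α j)) → j < i)
        ∧ Q (fun i => (Fintype.equivFin ι).symm (α i))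
    then ∏ m : Fin (Fintype.card ι - 1),
        (x ((Fintype.equivFin ι).symm (α (idxLo m))) -
          x ((Fintype.equivFin ι).symm (α (idxHi m))))⁻¹
    else 0

/-- In the word `w`, the element `u` immediately precedes the element `v`. -/
def immediatelyPrecedes {ι : Type*} [Fintype ι] (u v : ι)
    (w : Fin (Fintype.card ι) → ι) : Prop :=
  ∃ m : Fin (Fintype.card ι - 1), w (idxLo m) = u ∧ w (idxHi m) = v

theorem greeneSumRestricted_add_not {ι : Type*} [Fintype ι] {K : Type*} [Field K]
    (r : ι → ι → Prop) (x : ι → K) (Q : (Fin (Fintype.card ι) → ι) → Prop) :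
    greeneSumRestricted r x Q + greeneSumRestricted r x (fun w => ¬ Q w) =
      greeneSumRestricted r x (fun _ => True) := by
  unfold greeneSumRestricted
  rw [← Finset.sum_add_distrib]
  refine Finset.sum_congr rfl fun α _ => ?_
  by_cases hQ : Q (fun i => (Fintype.equivFin ι).symm (α i)) <;> simp [hQ]

/-- The restricted Greene sum is continuous in the variable of `p` away from the values of the
other variables. -/
theorem continuousOn_greeneSumRestricted {ι : Type*} [Fintype ι] (r : ι → ι → Prop)
    (c : ι → ℂ) (p : ι) (Q : (Fin (Fintype.card ι) → ι) → Prop) {S : Set ℂ}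
    (hS : ∀ w ∈ S, ∀ e, w ≠ c e) :
    ContinuousOn (fun w => greeneSumRestricted r (Function.update c p w) Q) S := by
  unfold greeneSumRestricted
  refine continuousOn_finsetSum _ fun α _ => ?_
  split_ifs
  · refine continuousOn_finsetProd _ fun m _ => ?_
    have huv : (Fintype.equivFin ι).symm (α (idxLo m)) ≠
        (Fintype.equivFin ι).symm (α (idxHi m)) := by
      simp [idxLo, idxHi]
    generalize (Fintype.equivFin ι).symm (α (idxLo m)) = u at huv
    generalize (Fintype.equivFin ι).symm (α (idxHi m)) = v at huv
    by_cases hu : u = p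
    · subst hu
      simp only [Function.update_self, Function.update_of_ne huv.symm]
      exact (continuousOn_id.sub continuousOn_const).inv₀ fun w hw => sub_ne_zero.2 (hS w hw v)
    · by_cases hv : v = p
      · subst hv
        simp only [Function.update_self, Function.update_of_ne hu]
        exact (continuousOn_const.sub continuousOn_id).inv₀
          fun w hw => sub_ne_zero.2 (hS w hw u).symm
      · simp only [Function.update_of_ne hu, Function.update_of_ne hv]
        exact continuousOn_const
  · exact continuousOn_const

theorem prod_filter_lt_succ {n : ℕ} {M : Type*} [CommMonoid M] (g : Fin n → M) (i : Fin n) :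
    ∏ j ∈ Finset.univ.filter (fun j : Fin n => j.1 < i.1 + 1), g j =
      (∏ j ∈ Finset.univ.filter (fun j : Fin n => j.1 < i.1), g j) * g i := by
  have h : Finset.univ.filter (fun j : Fin n => j.1 < i.1 + 1) =
      insert i (Finset.univ.filter (fun j : Fin n => j.1 < i.1)) := by
    ext j
    simp only [Finset.mem_filter, Finset.mem_univ, true_and, Finset.mem_insert, Fin.ext_iff]
    omega
  rw [h, Finset.prod_insert (by simp), mul_comm]

/-- For connected finite posets `P_1, …, P_n`, each with a covering
pair `x ≺ z` (the variable of `x` being the common value `a`, the variable of `z`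
being the integration variable), writing `G(P_i) = G′(P_i)/(z−x) = G″(P_i)/(z−x) +
G‴(P_i)` (the `G″` part collecting the linear extensions in which `z` immediately
precedes `x`) and `G′_i = ∏_{j≤i} G′(P_j)`, `G″_i = ∏_{j≤i} G″(P_j)`, one has for
every `n > 1`
`F(x) = −Σ_i (1/2πi) ∮ G′_{i−1} G‴(P_i) F(z)/G″_i dz
+ (1/2πi) ∮ G′_n F(z)/(G″_n (z−x)) dz`. -/
theorem newton_series_of_poset_sequence
    (n : ℕ) (hn : 1 < n)
    (ι : Fin n → Type*) [∀ i, Fintype (ι i)]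
    (r : ∀ i, ι i → ι i → Prop)
    (hr : ∀ i, IsStrictOrder (ι i) (r i))
    (hconn : ∀ i, ∀ u v : ι i,
      Relation.ReflTransGen (fun a b => r i a b ∨ r i b a) u v)
    (zd xd : ∀ i, ι i)
    (hcov : ∀ i, r i (xd i) (zd i))
    (hcov' : ∀ i, ¬ ∃ u, r i (xd i) u ∧ r i u (zd i))
    (a : ℂ) (c : ∀ i, ι i → ℂ)
    (hca : ∀ i, c i (xd i) = a)
    (hcinj : ∀ i, Function.Injective (c i))
    (c₀ : ℂ) (R : ℝ) (hR : 0 < R)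
    (ha : a ∈ Metric.ball c₀ R)
    (hcball : ∀ i, ∀ e : ι i, c i e ∈ Metric.ball c₀ R)
    (F : ℂ → ℂ) (U : Set ℂ) (hU : IsOpen U) (hUball : Metric.closedBall c₀ R ⊆ U)
    (hF : DifferentiableOn ℂ F U)
    (GP G1 G2 G3 : Fin n → ℂ → ℂ) (G1c G2c : ℕ → ℂ → ℂ)
    (hGP : ∀ i zz, GP i zz = greeneSumRestricted (r i)
        (Function.update (c i) (zd i) zz) (fun _ => True))
    (hG1 : ∀ i zz, G1 i zz = (zz - a) * GP i zz)
    (hG2 : ∀ i zz, G2 i zz = (zz - a) * greeneSumRestricted (r i)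
        (Function.update (c i) (zd i) zz) (immediatelyPrecedes (zd i) (xd i)))
    (hG3 : ∀ i zz, G3 i zz = greeneSumRestricted (r i)
        (Function.update (c i) (zd i) zz)
        (fun w => ¬ immediatelyPrecedes (zd i) (xd i) w))
    (hG1c : ∀ m zz, G1c m zz = ∏ j ∈ Finset.univ.filter (fun j : Fin n => j.1 < m), G1 j zz)
    (hG2c : ∀ m zz, G2c m zz = ∏ j ∈ Finset.univ.filter (fun j : Fin n => j.1 < m), G2 j zz)
    (hne : ∀ zz ∈ Metric.sphere c₀ R, ∀ m : ℕ, m ≤ n → G2c m zz ≠ 0) :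
    F a =
      -(∑ i : Fin n, (2 * Real.pi * Complex.I)⁻¹ *
          ∮ zz in C(c₀, R), G1c i.1 zz * G3 i zz * F zz / G2c (i.1 + 1) zz) +
        (2 * Real.pi * Complex.I)⁻¹ *
          ∮ zz in C(c₀, R), G1c n zz * F zz / (G2c n zz * (zz - a)) := by
  have hsep : ∀ w ∈ Metric.sphere c₀ R, ∀ b ∈ Metric.ball c₀ R, w ≠ b := by
    rintro w hw _ hb rfl
    exact (Metric.mem_ball.1 hb).ne hw
  have hwa : ∀ w ∈ Metric.sphere c₀ R, w - a ≠ 0 := fun w hw => sub_ne_zero.2 (hsep w hw a ha)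
  have hcont : ∀ i Q, ContinuousOn (fun w => greeneSumRestricted (r i)
      (Function.update (c i) (zd i) w) Q) (Metric.sphere c₀ R) := fun i Q =>
    continuousOn_greeneSumRestricted _ _ _ _ fun w hw e => hsep w hw _ (hcball i e)
  have hsub : ContinuousOn (fun w : ℂ => w - a) (Metric.sphere c₀ R) := by fun_prop
  have hG1cont : ∀ m, ContinuousOn (G1c m) (Metric.sphere c₀ R) := by
    intro m
    rw [funext (hG1c m)]
    refine continuousOn_finsetProd _ fun j _ => ?_
    rw [funext (hG1 j)]
    simp only [hGP]
    exact hsub.mul (hcont j _)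
  have hG2cont : ∀ m, ContinuousOn (G2c m) (Metric.sphere c₀ R) := by
    intro m
    rw [funext (hG2c m)]
    refine continuousOn_finsetProd _ fun j _ => ?_
    rw [funext (hG2 j)]
    exact hsub.mul (hcont j _)
  have hG3cont : ∀ i, ContinuousOn (G3 i) (Metric.sphere c₀ R) := by
    intro i
    rw [funext (hG3 i)]
    exact hcont i _
  have hFcont : ContinuousOn F (Metric.sphere c₀ R) :=
    hF.continuousOn.mono (Metric.sphere_subset_closedBall.trans hUball)
  have hsplit : ∀ i w, G1 i w = G2 i w + (w - a) * G3 i w := by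
    intro i w
    rw [hG1, hG2, hG3, hGP, ← greeneSumRestricted_add_not (r i) _
      (immediatelyPrecedes (zd i) (xd i)), mul_add]
  have htele : ∀ w ∈ Metric.sphere c₀ R,
      G1c n w * F w / (G2c n w * (w - a)) -
        ∑ i : Fin n, G1c i.1 w * G3 i w * F w / G2c (i.1 + 1) w = (w - a)⁻¹ • F w := by
    intro w hw
    have hstep : ∀ i : Fin n, G1c i.1 w * G3 i w * F w / G2c (i.1 + 1) w =
        (G1c (i.1 + 1) w / G2c (i.1 + 1) w - G1c i.1 w / G2c i.1 w) * (F w / (w - a)) := by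
      intro i
      have h1 : G1c (i.1 + 1) w = G1c i.1 w * G1 i w := by
        rw [hG1c, hG1c, prod_filter_lt_succ]
      have h2 : G2c (i.1 + 1) w = G2c i.1 w * G2 i w := by
        rw [hG2c, hG2c, prod_filter_lt_succ]
      have hne1 := hne w hw (i.1 + 1) i.2
      rw [h2] at hne1
      have hA := left_ne_zero_of_mul hne1
      have hB := right_ne_zero_of_mul hne1
      have hC := hwa w hw
      rw [h1, h2, hsplit i w]
      field_simp
      ring
    have h0 : G1c 0 w / G2c 0 w = 1 := by simp [hG1c, hG2c]
    rw [Finset.sum_congr rfl fun i _ => hstep i, ← Finset.sum_mul,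
      Fin.sum_univ_eq_sum_range (fun i => G1c (i + 1) w / G2c (i + 1) w - G1c i w / G2c i w) n,
      Finset.sum_range_sub (fun i => G1c i w / G2c i w), h0, smul_eq_mul]
    have hA := hne w hw n le_rfl
    have hC := hwa w hw
    field_simp
    ring
  have hint1 : ∀ i : Fin n, CircleIntegrable
      (fun w => G1c i.1 w * G3 i w * F w / G2c (i.1 + 1) w) c₀ R := fun i =>
    ((((hG1cont _).mul (hG3cont i)).mul hFcont).div (hG2cont _)
      fun w hw => hne w hw _ i.2).circleIntegrable hR.le
  have hint2 : CircleIntegrable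
      (fun w => G1c n w * F w / (G2c n w * (w - a))) c₀ R :=
    (((hG1cont n).mul hFcont).div ((hG2cont n).mul hsub)
      fun w hw => mul_ne_zero (hne w hw n le_rfl) (hwa w hw)).circleIntegrable hR.le
  have hcauchy := (hF.mono hUball).diffContOnCl_ball subset_rfl
    |>.two_pi_i_inv_smul_circleIntegral_sub_inv_smul ha
  rw [← circleIntegral.integral_congr hR.le htele,
    circleIntegral.integral_sub hint2 (CircleIntegrable.fun_sum _ fun i _ => hint1 i),
    circleIntegral.integral_fun_sum fun i _ => hint1 i, smul_eq_mul] at hcauchy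
  rw [← hcauchy, ← Finset.mul_sum]
  ring

end
end

section
/- Let x_1,…,x_n be pairwise distinct elements of a field K, F : K → K a function, and x an element of K distinct from all x_i. Then the Lagrange interpolation polynomial L_F(x) = Σ_{i=1}^n F(x_i) f(x)/((x − x_i) f′(x_i)) satisfies L_F(x) = f(x) · Σ_{α ∈ S_n} F(x_{α(1)}) / ( (x − x_{α(1)}) (x_{α(1)} − x_{α(2)}) (x_{α(2)} − x_{α(3)}) ⋯ (x_{α(n−1)} − x_{α(n)}) ), where the sum is over all permutations α of {1,…,n} and f(x) = ∏_{i=1}^n (x − x_i). -/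
open scoped Classical

noncomputable section

/-- The product of the inverse differences of consecutive terms of `z, y 0, y 1, …`. -/
def chainInv {K : Type*} [Field K] {n : ℕ} (z : K) (y : Fin n → K) : K :=
  ∏ m : Fin n, ((Fin.cons z y : Fin (n + 1) → K) m.castSucc - y m)⁻¹

theorem chainInv_succ {K : Type*} [Field K] {n : ℕ} (z : K) (y : Fin (n + 1) → K) :
    chainInv z y = (z - y 0)⁻¹ * chainInv (y 0) (fun j => y j.succ) := by
  unfold chainInv
  rw [Fin.prod_univ_succ]
  congr 1
  refine Finset.prod_congr rfl fun m _ => ?_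
  congr 2
  cases n with
  | zero => exact m.elim0
  | succ n => cases m using Fin.cases <;> rfl

/-- Sums over permutations of `Fin (n + 1)`, split by the image of `0`. -/
theorem sum_perm_succ {M : Type*} [AddCommMonoid M] {n : ℕ} (g : Equiv.Perm (Fin (n + 1)) → M) :
    ∑ α, g α = ∑ p, ∑ β, g (Equiv.Perm.decomposeFin.symm (p, β)) := by
  rw [← Equiv.sum_comp Equiv.Perm.decomposeFin.symm g, Fintype.sum_prod_type]

theorem prod_swap_succ {M : Type*} [CommMonoid M] {n : ℕ} (p : Fin (n + 1))
    (g : Fin (n + 1) → M) :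
    ∏ j : Fin n, g (Equiv.swap 0 p j.succ) = ∏ j ∈ Finset.univ.erase p, g j := by
  have hinj : Function.Injective fun j : Fin n => Equiv.swap 0 p j.succ :=
    (Equiv.swap 0 p).injective.comp (Fin.succ_injective n)
  rw [← Finset.prod_image (f := g) (s := Finset.univ)
    (g := fun j : Fin n => Equiv.swap 0 p j.succ)]
  · congr 1
    refine Finset.eq_of_subset_of_card_le ?_ ?_
    · intro k hk
      obtain ⟨j, -, rfl⟩ := Finset.mem_image.1 hk
      refine Finset.mem_erase.2 ⟨fun h => Fin.succ_ne_zero j ?_, Finset.mem_univ _⟩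
      exact (Equiv.swap 0 p).injective (h.trans (Equiv.swap_apply_left 0 p).symm)
    · rw [Finset.card_image_of_injective _ hinj]
      simp
  · exact hinj.injOn

/-- Partial fraction decomposition of `1 / ∏ (z - y j)`. -/
theorem sum_inv_mul_prod_inv {K : Type*} [Field K] {n : ℕ} (z : K) (y : Fin (n + 1) → K)
    (hy : Function.Injective y) (hz : ∀ i, z ≠ y i) :
    ∑ p, (z - y p)⁻¹ * ∏ j ∈ Finset.univ.erase p, (y p - y j)⁻¹ = ∏ j, (z - y j)⁻¹ := by
  have h := congrArg (Polynomial.eval z)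
    (Lagrange.sum_basis (s := Finset.univ) hy.injOn Finset.univ_nonempty)
  rw [Polynomial.eval_finsetSum, Polynomial.eval_one] at h
  rw [← mul_one (∏ j, (z - y j)⁻¹), ← h, Finset.mul_sum]
  refine Finset.sum_congr rfl fun p _ => ?_
  rw [Lagrange.eval_basis_not_at_node (Finset.mem_univ p) (hz p), Lagrange.eval_nodal,
    Lagrange.nodalWeight, ← mul_assoc, ← Finset.prod_mul_distrib,
    Finset.prod_eq_one fun j _ => inv_mul_cancel₀ (sub_ne_zero.2 (hz j)), one_mul, mul_comm]

theorem sum_perm_chainInv {K : Type*} [Field K] {n : ℕ} (z : K) (y : Fin n → K)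
    (hy : Function.Injective y) (hz : ∀ i, z ≠ y i) :
    ∑ α : Equiv.Perm (Fin n), chainInv z (fun i => y (α i)) = ∏ j, (z - y j)⁻¹ := by
  induction n generalizing z with
  | zero => simp [chainInv]
  | succ n ih =>
    rw [sum_perm_succ, ← sum_inv_mul_prod_inv z y hy hz]
    refine Finset.sum_congr rfl fun p _ => ?_
    simp only [chainInv_succ, Equiv.Perm.decomposeFin_symm_apply_zero,
      Equiv.Perm.decomposeFin_symm_apply_succ]
    rw [← Finset.mul_sum, ← prod_swap_succ p fun k => (y p - y k)⁻¹,
      ih (y p) (fun j => y (Equiv.swap 0 p j.succ))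
        (hy.comp ((Equiv.swap 0 p).injective.comp (Fin.succ_injective n)))]
    intro i h
    refine Fin.succ_ne_zero i ((Equiv.swap 0 p).injective ?_)
    rw [Equiv.swap_apply_left]
    exact (hy h).symm

/-- The Lagrange interpolation polynomial
`L_F(x) = Σ_i F(x_i) f(x)/((x − x_i) f'(x_i))` satisfies
`L_F(x) = f(x) Σ_{α ∈ S_n} F(x_{α(1)}) / ((x − x_{α(1)})(x_{α(1)} − x_{α(2)}) ⋯
(x_{α(n−1)} − x_{α(n)}))`. -/
theorem lagrange_eq_sum_over_permutations
    {K : Type*} [Field K] [CharZero K]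
    {n : ℕ} (hn : 0 < n)
    (xv : Fin n → K) (hxv : Function.Injective xv) (F : K → K)
    (x : K) (hx : ∀ i, x ≠ xv i) :
    ∑ i : Fin n, F (xv i) * (∏ j : Fin n, (x - xv j)) /
        ((x - xv i) * ∏ j ∈ Finset.univ.erase i, (xv i - xv j)) =
      (∏ j : Fin n, (x - xv j)) *
        ∑ α : Equiv.Perm (Fin n),
          F (xv (α ⟨0, hn⟩)) /
            ((x - xv (α ⟨0, hn⟩)) *
              ∏ m : Fin (n - 1), (xv (α (idxLo m)) - xv (α (idxHi m)))) := by
  obtain ⟨n, rfl⟩ : ∃ k, n = k + 1 := ⟨n - 1, by omega⟩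
  have key (α : Equiv.Perm (Fin (n + 1))) :
      F (xv (α ⟨0, hn⟩)) / ((x - xv (α ⟨0, hn⟩)) *
        ∏ m : Fin (n + 1 - 1), (xv (α (idxLo m)) - xv (α (idxHi m)))) =
      F (xv (α 0)) * chainInv x (fun i => xv (α i)) := by
    rw [div_eq_mul_inv, mul_inv, ← Finset.prod_inv_distrib, chainInv, Fin.prod_univ_succ]
    rfl
  simp only [key]
  rw [sum_perm_succ, Finset.mul_sum]
  refine Finset.sum_congr rfl fun p _ => ?_
  simp only [chainInv_succ, Equiv.Perm.decomposeFin_symm_apply_zero,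
    Equiv.Perm.decomposeFin_symm_apply_succ]
  have hinj : Function.Injective fun j : Fin n => Equiv.swap 0 p j.succ :=
    (Equiv.swap 0 p).injective.comp (Fin.succ_injective n)
  rw [← Finset.mul_sum, ← Finset.mul_sum,
    sum_perm_chainInv (xv p) (fun j => xv (Equiv.swap 0 p j.succ)) (hxv.comp hinj),
    prod_swap_succ p fun k => (xv p - xv k)⁻¹, Finset.prod_inv_distrib, div_eq_mul_inv, mul_inv]
  · ring
  · intro i h
    refine Fin.succ_ne_zero i ((Equiv.swap 0 p).injective ?_)
    rw [Equiv.swap_apply_left]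
    exact (hxv h).symm

end
end

section
/- Let P be a finite poset on {1,…,n} whose elements are identified with the variables x_1,…,x_n, and suppose the identity permutation is a linear extension of P (i.e. x_i ≺ x_j in P implies i > j). In the exterior algebra over the rational function field K = ℚ(x_1,…,x_n) of the free K-module with basis dx_1,…,dx_n, set η_{ij} = (dx_i − dx_j)/(x_i − x_j). Then Σ_{α ∈ L(P)} sign(α) · η_{α(1)α(2)} ∧ η_{α(2)α(3)} ∧ ⋯ ∧ η_{α(n−1)α(n)} = ( Σ_{i=1}^{n} (−1)^{n−i} dx_1 ∧ ⋯ ∧ dx_{i−1} ∧ dx_{i+1} ∧ ⋯ ∧ dx_n ) · G(P), where G(P) = Σ_{α ∈ L(P)} ∏_{i=1}^{n−1} (x_{α(i)} − x_{α(i+1)})^{−1} is the Greene sum of P. -/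
open scoped Classical

set_option synthInstance.maxHeartbeats 1000000
set_option maxHeartbeats 1000000

noncomputable section

/-- The rational function field `K = ℚ(x_1, …, x_n)`. -/
abbrev RatFuncField (n : ℕ) := FractionRing (MvPolynomial (Fin n) ℚ)

/-- The variable `x_i` as an element of `ℚ(x_1, …, x_n)`. -/
def Xvar {n : ℕ} (i : Fin n) : RatFuncField n :=
  algebraMap (MvPolynomial (Fin n) ℚ) (RatFuncField n) (MvPolynomial.X i)

/-- The basis element `dx_i` of the free module `K^n`, viewed inside its exterior
algebra. -/
def dx {n : ℕ} (i : Fin n) :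
    ExteriorAlgebra (RatFuncField n) (Fin n → RatFuncField n) :=
  ExteriorAlgebra.ι (RatFuncField n) (Pi.single i (1 : RatFuncField n))

/-- `η_{ij} = (dx_i − dx_j)/(x_i − x_j)`, i.e. `2πi` times the Arnold form `ω_{ij}`. -/
def eta {n : ℕ} (i j : Fin n) :
    ExteriorAlgebra (RatFuncField n) (Fin n → RatFuncField n) :=
  (Xvar i - Xvar j)⁻¹ • (dx i - dx j)

namespace ExteriorAlgebra

open CliffordAlgebra

variable {R M : Type*} [CommRing R] [AddCommGroup M] [Module R M]

/-- Multiplying the product of consecutive differences `v m - v (m + 1)` by the last vector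
gives the product of all the vectors. -/
theorem prod_ofFn_sub_mul_last {k : ℕ} (v : Fin (k + 1) → M) :
    (List.ofFn fun m : Fin k => ι R (v m.castSucc) - ι R (v m.succ)).prod * ι R (v (Fin.last k)) =
      (List.ofFn fun m => ι R (v m)).prod := by
  induction k with
  | zero => simp
  | succ k ih =>
    have h := ih (fun m => v m.succ)
    rw [List.ofFn_succ, List.prod_cons, mul_assoc]
    simp only [← Fin.succ_castSucc, ← Fin.succ_last] at h ⊢
    rw [h, List.ofFn_succ (f := fun m => ι R (v m)), List.prod_cons, sub_mul,
      Fin.castSucc_zero, sub_eq_self, List.ofFn_succ, List.prod_cons, ← mul_assoc, ι_sq_zero,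
      zero_mul]

theorem contractRight_prod_ofFn (φ : Module.Dual R M) {k : ℕ} (v : Fin k → M) :
    contractRight (Q := (0 : QuadraticForm R M)) (List.ofFn fun m => ι R (v m)).prod φ =
      ∑ i : Fin k, ((-1 : R) ^ (k - 1 - i.1) * φ (v i)) •
        ((List.ofFn fun m => ι R (v m)).eraseIdx i.1).prod := by
  induction k with
  | zero => simp
  | succ k ih =>
    rw [List.ofFn_succ', List.concat_eq_append, List.prod_append, List.prod_singleton]
    refine (contractRight_mul_ι (Q := (0 : QuadraticForm R M)) _ _ _).trans ?_
    rw [ih (fun m => v m.castSucc), Fin.sum_univ_castSucc, Finset.sum_mul, sub_eq_neg_add,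
      ← Finset.sum_neg_distrib]
    congr 1
    · refine Finset.sum_congr rfl fun i _ => ?_
      have hi : k + 1 - 1 - i.1 = k - 1 - i.1 + 1 := by omega
      rw [Fin.val_castSucc, List.eraseIdx_append_of_lt_length (by simp), List.prod_append,
        List.prod_singleton, hi, pow_succ, mul_neg_one, neg_mul, neg_smul, smul_mul_assoc]
    · rw [List.eraseIdx_append_of_length_le (by simp)]
      simp

theorem contractRight_prod_eq_zero (φ : Module.Dual R M) {k : ℕ} (v : Fin k → M)
    (h : ∀ m, φ (v m) = 0) :
    contractRight (Q := (0 : QuadraticForm R M)) (List.ofFn fun m => ι R (v m)).prod φ = 0 := by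
  rw [contractRight_prod_ofFn]
  exact Finset.sum_eq_zero fun i _ => by rw [h, mul_zero, zero_smul]

/-- If `φ` takes the value `1` on all the vectors, the product of their consecutive differences
is the contraction of their product with `φ`. -/
theorem prod_ofFn_sub_eq_contractRight {k : ℕ} (v : Fin (k + 1) → M) (φ : Module.Dual R M)
    (hφ : ∀ m, φ (v m) = 1) :
    (List.ofFn fun m : Fin k => ι R (v m.castSucc) - ι R (v m.succ)).prod =
      contractRight (Q := (0 : QuadraticForm R M)) (List.ofFn fun m => ι R (v m)).prod φ := by
  have h0 := contractRight_prod_eq_zero φ (fun m : Fin k => v m.castSucc - v m.succ)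
    fun m => by rw [map_sub, hφ, hφ, sub_self]
  simp only [map_sub] at h0
  rw [← prod_ofFn_sub_mul_last]
  refine Eq.trans ?_ (contractRight_mul_ι (Q := (0 : QuadraticForm R M)) _ _ _).symm
  rw [h0, hφ, one_smul, zero_mul, sub_zero]

theorem prod_ofFn_ι_perm {k : ℕ} (v : Fin k → M) (α : Equiv.Perm (Fin k)) :
    (List.ofFn fun m => ι R (v (α m))).prod =
      (Equiv.Perm.sign α : ℤ) • (List.ofFn fun m => ι R (v m)).prod := by
  have h := (ιMulti R k (M := M)).map_perm v α
  simpa only [ιMulti_apply, Function.comp_apply, Units.smul_def] using h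

theorem prod_ofFn_smul {A : Type*} [Ring A] [Algebra R A] {k : ℕ} (c : Fin k → R) (a : Fin k → A) :
    (List.ofFn fun m => c m • a m).prod = (∏ m, c m) • (List.ofFn a).prod := by
  induction k with
  | zero => simp
  | succ k ih =>
    rw [List.ofFn_succ, List.prod_cons, ih, List.ofFn_succ, List.prod_cons, Fin.prod_univ_succ,
      smul_mul_smul_comm]

end ExteriorAlgebra

open ExteriorAlgebra in
theorem sign_smul_prod_dx_sub {k : ℕ} (α : Equiv.Perm (Fin (k + 1))) :
    (Equiv.Perm.sign α : ℤ) •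
        (List.ofFn fun m : Fin k => dx (α m.castSucc) - dx (α m.succ)).prod =
      ∑ i : Fin (k + 1), ((-1 : RatFuncField (k + 1)) ^ (k - i.1)) •
        ((List.ofFn fun m : Fin (k + 1) => dx m).eraseIdx i.1).prod := by
  let K := RatFuncField (k + 1)
  let e : Fin (k + 1) → Fin (k + 1) → K := fun i => Pi.single i 1
  let φ : Module.Dual K (Fin (k + 1) → K) := ∑ i, LinearMap.proj i
  have hφ (i) : φ (e i) = 1 := by simp [φ, e]
  have h := prod_ofFn_sub_eq_contractRight (fun m => e (α m)) φ fun m => hφ _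
  have hc := contractRight_prod_ofFn φ e
  simp only [hφ, mul_one] at hc
  rw [prod_ofFn_ι_perm e α, map_zsmul, LinearMap.smul_apply, hc] at h
  have hs : (Equiv.Perm.sign α : ℤ) * (Equiv.Perm.sign α : ℤ) = 1 := by
    rw [← Units.val_mul, Int.units_mul_self, Units.val_one]
  refine (congrArg ((Equiv.Perm.sign α : ℤ) • ·) h).trans ?_
  rw [smul_smul, hs, one_smul]
  rfl

/-- For a poset `P` on `{1, …, n}` whose identity permutation is a
linear extension,
`Σ_{α ∈ L(P)} sign(α) η_{α(1)α(2)} ∧ ⋯ ∧ η_{α(n−1)α(n)}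
= (Σ_i (−1)^{n−i} dx_1 ∧ ⋯ ∧ \widehat{dx_i} ∧ ⋯ ∧ dx_n) · G(P)`. -/
theorem arnold_forms_greene
    {n : ℕ} (hn : 0 < n)
    (r : Fin n → Fin n → Prop) (hr : IsStrictOrder (Fin n) r)
    (hid : ∀ i j, r i j → j < i) :
    ∑ α ∈ Finset.univ.filter
        (fun α : Equiv.Perm (Fin n) => ∀ i j, r (α i) (α j) → j < i),
      (Equiv.Perm.sign α : ℤ) •
        (List.ofFn fun m : Fin (n - 1) => eta (α (idxLo m)) (α (idxHi m))).prod =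
    (∑ α ∈ Finset.univ.filter
        (fun α : Equiv.Perm (Fin n) => ∀ i j, r (α i) (α j) → j < i),
      ∏ m : Fin (n - 1), (Xvar (α (idxLo m)) - Xvar (α (idxHi m)))⁻¹) •
      ∑ i : Fin n, ((-1 : RatFuncField n) ^ (n - 1 - i.1)) •
        ((List.ofFn fun m : Fin n => dx m).eraseIdx i.1).prod := by
  obtain ⟨k, rfl⟩ : ∃ k, n = k + 1 := ⟨n - 1, by omega⟩
  rw [Finset.sum_smul]
  refine Finset.sum_congr rfl fun α _ => ?_
  unfold eta
  rw [ExteriorAlgebra.prod_ofFn_smul, smul_comm]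
  exact congrArg _ (sign_smul_prod_dx_sub α)

end
end
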